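/- Let $T \in \mathfrak{P}_n$ and let $T'$ be the partial inverse of $T$. If $h$ is any completion of $T$ in the homeomorphism group of $\mathfrak{C}_n$, then $h^{-1}$ is a completion of $T'$. -/

import Mathlib

open Classical

noncomputable section

/-- `n`-ary Cantor space: infinite words over the alphabet `Fin n`. -/
abbrev Cantor (n : ℕ) : Type := ℕ → Fin n

/-- The finite word `w` is a prefix of the infinite word `χ`. -/
def PrefixOf {n : ℕ} (w : List (Fin n)) (χ : Cantor n) : Prop :=
  ∀ (i : ℕ) (h : i < w.length), w.get ⟨i, h⟩ = χ i

/-- Concatenation of a finite word with an infinite word. -/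
def appendInf {n : ℕ} (w : List (Fin n)) (χ : Cantor n) : Cantor n :=
  fun i => if h : i < w.length then w.get ⟨i, h⟩ else χ (i - w.length)

/-- The cone (basic clopen set) of infinite words having the finite word `w` as prefix. -/
def cone {n : ℕ} (w : List (Fin n)) : Set (Cantor n) :=
  {χ | PrefixOf w χ}

/-- The length-`k` prefix of an infinite word, as a finite word. -/
def takeW {n : ℕ} (χ : Cantor n) (k : ℕ) : List (Fin n) :=
  List.ofFn (fun i : Fin k => χ i)

/-- A finite family of finite words forming a maximal antichain:
every infinite word has exactly one member of the family as a prefix. -/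
def AntichainFam {n m : ℕ} (α : Fin m → List (Fin n)) : Prop :=
  ∀ χ : Cantor n, ∃! i : Fin m, PrefixOf (α i) χ

/-- The group structure on self-homeomorphisms of a topological space,
with `f * g` acting as `g` followed by `f`. -/
instance homeoGroup {X : Type*} [TopologicalSpace X] : Group (X ≃ₜ X) where
  mul f g := g.trans f
  one := Homeomorph.refl X
  inv := Homeomorph.symm
  mul_assoc a b c := Homeomorph.ext fun _ => rfl
  one_mul a := Homeomorph.ext fun _ => rfl
  mul_one a := Homeomorph.ext fun _ => rfl
  inv_mul_cancel a := Homeomorph.ext fun x => a.symm_apply_apply x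

/-- The Higman–Thompson group `Vₙ`, as the set of self-homeomorphisms of Cantor space
which act by exchanging finite prefixes along a pair of maximal antichains. -/
def Vn (n : ℕ) : Set (Cantor n ≃ₜ Cantor n) :=
  {g | ∃ (m : ℕ) (α β : Fin m → List (Fin n)), AntichainFam α ∧ AntichainFam β ∧
      ∀ (i : Fin m) (χ : Cantor n), g (appendInf (α i) χ) = appendInf (β i) χ}

/-- Conjugation in the paper's right-action convention: `paperConj g v = g⁻¹ v g`,
i.e. the homeomorphism `x ↦ (x) g⁻¹ v g` (first apply `g⁻¹`, then `v`, then `g`). -/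
def paperConj {n : ℕ} (g v : Cantor n ≃ₜ Cantor n) : Cantor n ≃ₜ Cantor n :=
  (g.symm.trans v).trans g

/-- `l` is the longest common prefix of the set `A` of infinite words. -/
def IsLCP {n : ℕ} (A : Set (Cantor n)) (l : List (Fin n)) : Prop :=
  (∀ ρ ∈ A, PrefixOf l ρ) ∧
    ∀ l' : List (Fin n), (∀ ρ ∈ A, PrefixOf l' ρ) → l'.length ≤ l.length

/-- A (not necessarily finite-state) transducer over the alphabet `Fin n`. -/
structure Transducer (n : ℕ) where
  /-- the set of states -/
  Q : Type
  /-- the transition function -/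
  tr : Fin n → Q → Q
  /-- the output (rewrite) function -/
  out : Fin n → Q → List (Fin n)

namespace Transducer

variable {n : ℕ}

/-- The transition function extended to finite words. -/
def transStar (T : Transducer n) : List (Fin n) → T.Q → T.Q
  | [], q => q
  | x :: w, q => T.transStar w (T.tr x q)

/-- The output function extended to finite words. -/
def outStar (T : Transducer n) : List (Fin n) → T.Q → List (Fin n)
  | [], _ => []
  | x :: w, q => T.out x q ++ T.outStar w (T.tr x q)

/-- The initial transducer `T_q` induces the map `f` on Cantor space: the outputs along
ever longer prefixes of `χ` are ever longer prefixes of `f χ`. -/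
def Induces (T : Transducer n) (q : T.Q) (f : Cantor n → Cantor n) : Prop :=
  ∀ (χ : Cantor n) (m : ℕ), ∃ k : ℕ,
    m ≤ (T.outStar (takeW χ k) q).length ∧ PrefixOf (T.outStar (takeW χ k) q) (f χ)

/-- The image of the state `q`: the image of Cantor space under the map induced by `T_q`. -/
def stateImage (T : Transducer n) (q : T.Q) : Set (Cantor n) :=
  {y | ∃ (f : Cantor n → Cantor n) (χ : Cantor n), T.Induces q f ∧ f χ = y}

/-- `T` is synchronizing at level `k`: the state reached after reading any word of
length `k` does not depend on the starting state. -/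
def SyncAtLevel (T : Transducer n) (k : ℕ) : Prop :=
  ∀ w : List (Fin n), w.length = k → ∀ q q' : T.Q, T.transStar w q = T.transStar w q'

/-- `T` is synchronizing if it is synchronizing at some level. -/
def Synchronizing (T : Transducer n) : Prop := ∃ k, T.SyncAtLevel k

/-- `T` (inducing the homeomorphism `h` at `q0`) is one-way synchronizing: `T` is
synchronizing, but the inverse homeomorphism is not induced by any finite
synchronizing transducer (equivalently, the inverse transducer is not synchronizing). -/
def OneWaySync (T : Transducer n) (q0 : T.Q) (h : Cantor n ≃ₜ Cantor n) : Prop :=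
  T.Induces q0 ⇑h ∧ T.Synchronizing ∧
    ¬ ∃ (S : Transducer n) (_ : Finite S.Q) (s0 : S.Q),
        S.Induces s0 ⇑h.symm ∧ S.Synchronizing

/-- `T` is equal to its core : every state is reached by reading a word of length `k`
from some state, for every synchronizing level `k`. -/
def EqualToCore (T : Transducer n) : Prop :=
  ∀ k : ℕ, T.SyncAtLevel k → ∀ q : T.Q, ∃ (w : List (Fin n)) (p : T.Q),
    w.length = k ∧ T.transStar w p = q

/-- Every state of `T` is accessible from `q0`. -/
def Accessible (T : Transducer n) (q0 : T.Q) : Prop :=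
  ∀ q : T.Q, ∃ w : List (Fin n), T.transStar w q0 = q

/-- The product transducer `T S` (first act by `T`, then by `S`). -/
def prod (T S : Transducer n) : Transducer n where
  Q := T.Q × S.Q
  tr := fun x p => (T.tr x p.1, S.transStar (T.out x p.1) p.2)
  out := fun x p => S.outStar (T.out x p.1) p.2

/-- `T` is partially invertible: every state induces an injective map on Cantor space
with clopen image. -/
def PartiallyInvertible (T : Transducer n) : Prop :=
  ∀ q : T.Q, ∃ f : Cantor n → Cantor n,
    T.Induces q f ∧ Function.Injective f ∧ IsClopen (Set.range f)

/-- `T` has no states of incomplete response: for each state `q` and letter `i`, no word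
strictly longer than `λ(i,q)` is a common prefix of the outputs on all of the cone `[i]`. -/
def NoIncompleteResponse (T : Transducer n) : Prop :=
  ∀ (q : T.Q) (i x : Fin n),
    ¬ ∀ χ : Cantor n, ∃ k : ℕ, (T.out i q ++ [x]) <+: T.outStar (i :: takeW χ k) q

/-- States `q` of `T` and `p` of `S` are `ω`-equivalent: they induce one and the same
map on Cantor space. -/
def OmegaEq (T : Transducer n) (q : T.Q) (S : Transducer n) (p : S.Q) : Prop :=
  ∃ f : Cantor n → Cantor n, T.Induces q f ∧ S.Induces p f

/-- `T` is minimal: no states of incomplete response and no pair of distinct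
`ω`-equivalent states. -/
def Minimal (T : Transducer n) : Prop :=
  T.NoIncompleteResponse ∧ ∀ q q' : T.Q, T.OmegaEq q T q' → q = q'

/-- The map on Cantor space induced by the state `q` (junk value if none exists). -/
def inducedMap (T : Transducer n) (q : T.Q) : Cantor n → Cantor n :=
  if h : ∃ f, T.Induces q f then h.choose else id

/-- `𝓛_q(α)`: the longest common prefix of the preimage of the cone `[α]` under `T_q`
(junk value if it does not exist). -/
def lcp (T : Transducer n) (q : T.Q) (α : List (Fin n)) : List (Fin n) :=
  if h : ∃ l, IsLCP {ρ : Cantor n | T.inducedMap q ρ ∈ cone α} l then h.choose else []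

/-- The inverse transducer of `T` given by the inversion algorithm, on the set of all
pairs `(w, q)`: reading `x` from `(w,q)` outputs `𝓛_q(wx)` and moves to
`(wx - λ(𝓛_q(wx), q), π(𝓛_q(wx), q))`. -/
def invT (T : Transducer n) : Transducer n where
  Q := List (Fin n) × T.Q
  tr := fun x p =>
    ((p.1 ++ [x]).drop (T.outStar (T.lcp p.2 (p.1 ++ [x])) p.2).length,
      T.transStar (T.lcp p.2 (p.1 ++ [x])) p.2)
  out := fun x p => T.lcp p.2 (p.1 ++ [x])

/-- Restriction of a transducer to a set of states (transitions leaving the set are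
replaced by junk loops; for transition-closed sets this is the honest restriction). -/
def restrictTo (T : Transducer n) (P : T.Q → Prop) : Transducer n where
  Q := {q : T.Q // P q}
  tr := fun x q => if h : P (T.tr x q.1) then ⟨T.tr x q.1, h⟩ else q
  out := fun x q => T.out x q.1

/-- The set of states reachable from `q0`. -/
def reach (T : Transducer n) (q0 : T.Q) : T.Q → Prop :=
  fun q => ∃ w : List (Fin n), T.transStar w q0 = q

/-- The inverse transducer of the initial transducer `T_{q0}`, with state set the states
accessible from `(ε, q0)`. -/
def invAcc (T : Transducer n) (q0 : T.Q) : Transducer n :=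
  (T.invT).restrictTo ((T.invT).reach ([], q0))

/-- A pair `(w,p)` is good if `[w] ⊆ im(T_p)` and `𝓛_p(w) = ε`. -/
def GoodPair (T : Transducer n) (p : List (Fin n) × T.Q) : Prop :=
  cone p.1 ⊆ T.stateImage p.2 ∧
    IsLCP {ρ : Cantor n | T.inducedMap p.2 ρ ∈ cone p.1} []

/-- The partial inverse `T'` of a partially invertible transducer `T`: the inverse
transducer restricted to the good pairs `(w,p)` with `[w] ⊆ im(T_p)`, `𝓛_p(w) = ε`. -/
def partialInv (T : Transducer n) : Transducer n :=
  (T.invT).restrictTo T.GoodPair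

/-- `h` is a completion of `T`: there are a maximal antichain `η` and an effective viable
combination `(ρ, p)` such that `h` maps `η_i χ` to `ρ_i (χ)T_{p_i}`. -/
def IsCompletion (T : Transducer n) (h : Cantor n ≃ₜ Cantor n) : Prop :=
  ∃ (l : ℕ) (η ρ : Fin l → List (Fin n)) (p : Fin l → T.Q)
      (f : Fin l → (Cantor n → Cantor n)),
    l % (n - 1) = 1 % (n - 1) ∧
    AntichainFam η ∧
    (∀ i, T.Induces (p i) (f i)) ∧
    (⋃ i, appendInf (ρ i) '' Set.range (f i)) = Set.univ ∧
    (∀ i j, i ≠ j →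
      Disjoint (appendInf (ρ i) '' Set.range (f i))
        (appendInf (ρ j) '' Set.range (f j))) ∧
    ∀ (i : Fin l) (χ : Cantor n), h (appendInf (η i) χ) = appendInf (ρ i) (f i χ)

/-- The group `𝓗(T)` generated by all completions of `T`. -/
def HGroup (T : Transducer n) : Subgroup (Cantor n ≃ₜ Cantor n) :=
  Subgroup.closure {h | T.IsCompletion h}

/-- The subgroup-generating equivalence relation induced by the automaton underlying a
transducer `A` with start state `a0` (by Lemma 4.1, two words are related iff the states
they reach are identified by the collapsing procedure, i.e. iff the reached states
transition identically on all sufficiently long words). -/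
def simA (A : Transducer n) (a0 : A.Q) (α β : List (Fin n)) : Prop :=
  ∃ i : ℕ, ∀ w : List (Fin n), w.length = i →
    A.transStar w (A.transStar α a0) = A.transStar w (A.transStar β a0)

/-- `if b then T else T'`. -/
def factor (T : Transducer n) (b : Bool) : Transducer n :=
  if b then T else T.partialInv

/-- The product of a nonempty list of factors, each equal to `T` or its partial
inverse `T'`; these products make up the set `Π(T)`. -/
def prodOf (T : Transducer n) : List Bool → Transducer n
  | [] => T
  | [b] => T.factor b
  | b :: c :: rest => (T.factor b).prod (T.prodOf (c :: rest))

/-- `T` is contracting: every state of every product of copies of `T` and `T'` is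
`ω`-equivalent to an initial transducer which, after reading some fixed length of input,
always acts as a state of `T`. -/
def Contracting (T : Transducer n) : Prop :=
  ∀ L : List Bool, L ≠ [] → ∀ q : (T.prodOf L).Q,
    ∃ (V : Transducer n) (p : V.Q) (f : Cantor n → Cantor n),
      (T.prodOf L).Induces q f ∧ V.Induces p f ∧
      ∃ j : ℕ, ∀ w : List (Fin n), w.length = j →
        ∃ (u : T.Q) (g : Cantor n → Cantor n),
          V.Induces (V.transStar w p) g ∧ T.Induces u g

end Transducer

/-- The element `v` of `Vₙ` preserves the relation `r` on nonempty finite words: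
whenever `v` replaces the prefix `α` by `β`, the words `α` and `β` are related. -/
def PreservesRel {n : ℕ} (r : List (Fin n) → List (Fin n) → Prop)
    (g : Cantor n ≃ₜ Cantor n) : Prop :=
  ∀ (α β : List (Fin n)), α ≠ [] → β ≠ [] →
    (∀ χ : Cantor n, g (appendInf α χ) = appendInf β χ) → r α β

/-- The subgroup `V_∼` of `Vₙ` generated by the prefix-exchange homeomorphisms
preserving the relation `r`. -/
def VSim (n : ℕ) (r : List (Fin n) → List (Fin n) → Prop) :
    Subgroup (Cantor n ≃ₜ Cantor n) :=
  Subgroup.closure {g | g ∈ Vn n ∧ PreservesRel r g}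

/-- `f` coincides with `g` on the cone `[α]` (conjugated into the cone) and is the
identity off the cone: the homeomorphism `[α]_g`. -/
def IsRestrTo {n : ℕ} (α : List (Fin n)) (g f : Cantor n ≃ₜ Cantor n) : Prop :=
  (∀ χ : Cantor n, f (appendInf α χ) = appendInf α (g χ)) ∧
  ∀ χ : Cantor n, ¬ PrefixOf α χ → f χ = χ

/-- The Nekrashevych group `Vₙ(G)`: the group generated by `Vₙ` together with all the
homeomorphisms `[α]_g` for `g ∈ G`. -/
def NekG (n : ℕ) (G : Subgroup (Cantor n ≃ₜ Cantor n)) :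
    Subgroup (Cantor n ≃ₜ Cantor n) :=
  Subgroup.closure (Vn n ∪ {f | ∃ (α : List (Fin n)) (g : Cantor n ≃ₜ Cantor n),
    g ∈ G ∧ IsRestrTo α g f})

/-- The homeomorphism `f` locally agrees with the set `G` of homeomorphisms. -/
def LocallyAgrees {n : ℕ} (G : Set (Cantor n ≃ₜ Cantor n))
    (f : Cantor n ≃ₜ Cantor n) : Prop :=
  ∀ x : Cantor n, ∃ U : Set (Cantor n), IsOpen U ∧ x ∈ U ∧
    ∃ g ∈ G, Set.EqOn ⇑f ⇑g U

/-- A finite synchronous invertible transducer over `Fin n`: each state rewrites single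
letters to single letters bijectively. -/
structure SyncTransducer (n : ℕ) where
  /-- the set of states -/
  Q : Type
  /-- there are finitely many states -/
  fin : Finite Q
  /-- the transition function -/
  tr : Fin n → Q → Q
  /-- the (single-letter) output function -/
  out : Fin n → Q → Fin n
  /-- each state rewrites letters bijectively -/
  bij : ∀ q : Q, Function.Bijective fun x => out x q

namespace SyncTransducer

variable {n : ℕ}

/-- The transition function extended to finite words. -/
def trStar (U : SyncTransducer n) : List (Fin n) → U.Q → U.Q
  | [], q => q
  | x :: w, q => U.trStar w (U.tr x q)

/-- The output function extended to finite words. -/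
def outWord (U : SyncTransducer n) : List (Fin n) → U.Q → List (Fin n)
  | [], _ => []
  | x :: w, q => U.out x q :: U.outWord w (U.tr x q)

/-- The map on Cantor space induced by the initial transducer `U_q`. -/
def applyFun (U : SyncTransducer n) (q : U.Q) (χ : Cantor n) : Cantor n :=
  fun i => U.out (χ i) (U.trStar (takeW χ i) q)

/-- The inverse transducer of a synchronous invertible transducer. -/
def inv (U : SyncTransducer n) : SyncTransducer n where
  Q := U.Q
  fin := U.fin
  tr := fun y q => U.tr ((Equiv.ofBijective _ (U.bij q)).symm y) q
  out := fun y q => (Equiv.ofBijective _ (U.bij q)).symm y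
  bij := fun q => (Equiv.ofBijective _ (U.bij q)).symm.bijective

/-- The product of synchronous transducers (first act by `T`, then by `S`). -/
def sprod (T S : SyncTransducer n) : SyncTransducer n where
  Q := T.Q × S.Q
  fin := by
    haveI := T.fin; haveI := S.fin
    infer_instance
  tr := fun x p => (T.tr x p.1, S.tr (T.out x p.1) p.2)
  out := fun x p => S.out (T.out x p.1) p.2
  bij := fun p => (S.bij p.2).comp (T.bij p.1)

/-- `U` is synchronizing at level `k`. -/
def SyncAtLevel (U : SyncTransducer n) (k : ℕ) : Prop :=
  ∀ w : List (Fin n), w.length = k → ∀ q q' : U.Q, U.trStar w q = U.trStar w q'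

/-- `U` is synchronizing. -/
def Synchronizing (U : SyncTransducer n) : Prop := ∃ k, U.SyncAtLevel k

/-- `U` is minimal (under `ω`-equivalence): distinct states induce distinct maps. -/
def Minimal (U : SyncTransducer n) : Prop :=
  ∀ q q' : U.Q, U.applyFun q = U.applyFun q' → q = q'

/-- One-way synchronizing: `U` is synchronizing but the inverse homeomorphism of
`h = U_{q0}` is not induced by any finite synchronizing transducer. -/
def OneWaySync (U : SyncTransducer n) (h : Cantor n ≃ₜ Cantor n) : Prop :=
  U.Synchronizing ∧
    ¬ ∃ (S : Transducer n) (_ : Finite S.Q) (s0 : S.Q),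
        S.Induces s0 ⇑h.symm ∧ S.Synchronizing

/-- `U` is equal to its core. -/
def EqualToCore (U : SyncTransducer n) : Prop :=
  ∀ k : ℕ, U.SyncAtLevel k → ∀ q : U.Q, ∃ (w : List (Fin n)) (p : U.Q),
    w.length = k ∧ U.trStar w p = q

/-- The underlying (asynchronous-format) transducer of a synchronous transducer. -/
def toT (U : SyncTransducer n) : Transducer n :=
  ⟨U.Q, U.tr, fun x q => [U.out x q]⟩

/-- The automaton group `𝒢(U)` generated by `U`: the subgroup of the homeomorphism
group of Cantor space generated by the homeomorphisms `U_q` for the states `q`. -/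
def autG (U : SyncTransducer n) : Subgroup (Cantor n ≃ₜ Cantor n) :=
  Subgroup.closure {f : Cantor n ≃ₜ Cantor n | ∃ q : U.Q, ⇑f = U.applyFun q}

end SyncTransducer

section CantorWords

variable {n : ℕ}

theorem mem_cone_iff {w : List (Fin n)} {χ : Cantor n} : χ ∈ cone w ↔ PrefixOf w χ := Iff.rfl

theorem prefixOf_iff_getElem {w : List (Fin n)} {χ : Cantor n} :
    PrefixOf w χ ↔ ∀ (i : ℕ) (h : i < w.length), w[i] = χ i := Iff.rfl

theorem prefixOf_nil (χ : Cantor n) : PrefixOf [] χ := fun i hi => absurd hi (Nat.not_lt_zero i)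

theorem prefixOf_appendInf (w : List (Fin n)) (χ : Cantor n) : PrefixOf w (appendInf w χ) := by
  intro i hi
  simp [appendInf, hi]

theorem appendInf_append (u v : List (Fin n)) (χ : Cantor n) :
    appendInf (u ++ v) χ = appendInf u (appendInf v χ) := by
  funext i
  simp only [appendInf, List.length_append, List.get_eq_getElem]
  by_cases h₁ : i < u.length
  · simp [h₁, Nat.lt_add_right]
  · by_cases h₂ : i - u.length < v.length
    · have h₃ : i < u.length + v.length := by omega
      simp [h₁, h₂, h₃, List.getElem_append_right (not_lt.mp h₁)]
    · have h₃ : ¬ i < u.length + v.length := by omega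
      simp [h₁, h₂, h₃, Nat.sub_add_eq]

theorem appendInf_injective (w : List (Fin n)) :
    Function.Injective (appendInf w : Cantor n → Cantor n) := by
  intro χ ψ h
  funext i
  simpa [appendInf] using congrFun h (w.length + i)

theorem PrefixOf.exists_appendInf {w : List (Fin n)} {χ : Cantor n} (h : PrefixOf w χ) :
    ∃ δ, χ = appendInf w δ := by
  refine ⟨fun i => χ (w.length + i), ?_⟩
  funext i
  by_cases hi : i < w.length
  · simpa [appendInf, hi] using (h i hi).symm
  · simp [appendInf, hi, Nat.add_sub_cancel' (not_lt.mp hi)]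

theorem range_appendInf (w : List (Fin n)) : Set.range (appendInf w) = cone w :=
  Set.ext fun _ => ⟨by rintro ⟨δ, rfl⟩; exact prefixOf_appendInf w δ,
    fun h => let ⟨δ, hδ⟩ := PrefixOf.exists_appendInf h; ⟨δ, hδ.symm⟩⟩

theorem prefixOf_append_appendInf_iff {u v : List (Fin n)} {χ : Cantor n} :
    PrefixOf (u ++ v) (appendInf u χ) ↔ PrefixOf v χ := by
  constructor
  · intro h
    obtain ⟨δ, hδ⟩ := h.exists_appendInf
    rw [appendInf_append] at hδ
    rw [appendInf_injective u hδ]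
    exact prefixOf_appendInf v δ
  · intro h
    obtain ⟨δ, rfl⟩ := h.exists_appendInf
    rw [← appendInf_append]
    exact prefixOf_appendInf _ δ

theorem PrefixOf.mono {u v : List (Fin n)} {χ : Cantor n} (h : PrefixOf v χ) (huv : u <+: v) :
    PrefixOf u χ := by
  obtain ⟨t, rfl⟩ := huv
  obtain ⟨δ, rfl⟩ := h.exists_appendInf
  rw [appendInf_append]
  exact prefixOf_appendInf u _

theorem PrefixOf.prefix_of_length_le {u v : List (Fin n)} {χ : Cantor n} (hu : PrefixOf u χ)
    (hv : PrefixOf v χ) (huv : u.length ≤ v.length) : u <+: v := by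
  rw [List.prefix_iff_eq_take]
  refine List.ext_getElem (by simpa using huv) fun i h₁ h₂ => ?_
  rw [List.getElem_take]
  exact (hu i h₁).trans (hv i (h₁.trans_le huv)).symm

theorem length_takeW (χ : Cantor n) (k : ℕ) : (takeW χ k).length = k := by simp [takeW]

theorem prefixOf_takeW_iff {χ ψ : Cantor n} {k : ℕ} :
    PrefixOf (takeW χ k) ψ ↔ ∀ i < k, χ i = ψ i := by
  simp [prefixOf_iff_getElem, takeW]

theorem prefixOf_takeW (χ : Cantor n) (k : ℕ) : PrefixOf (takeW χ k) χ :=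
  prefixOf_takeW_iff.2 fun _ _ => rfl

theorem cone_takeW (χ : Cantor n) (k : ℕ) : cone (takeW χ k) = PiNat.cylinder χ k := by
  ext ψ
  simp only [mem_cone_iff, prefixOf_takeW_iff, PiNat.mem_cylinder_iff, eq_comm]

theorem PrefixOf.eq_takeW {w : List (Fin n)} {χ : Cantor n} (h : PrefixOf w χ) :
    w = takeW χ w.length :=
  (h.prefix_of_length_le (prefixOf_takeW χ _) (length_takeW χ _).ge).eq_of_length
    (length_takeW χ _).symm

theorem cone_anti {u v : List (Fin n)} (h : u <+: v) : cone v ⊆ cone u :=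
  fun _ hχ => PrefixOf.mono hχ h

theorem cone_takeW_anti (χ : Cantor n) {k l : ℕ} (h : k ≤ l) :
    cone (takeW χ l) ⊆ cone (takeW χ k) := by
  simpa only [cone_takeW] using PiNat.cylinder_anti χ h

theorem isOpen_cone (w : List (Fin n)) : IsOpen (cone w) := by
  rw [isOpen_iff_mem_nhds]
  intro χ hχ
  rw [hχ.eq_takeW, cone_takeW]
  exact (PiNat.isOpen_cylinder _ χ _).mem_nhds (PiNat.self_mem_cylinder χ _)

theorem exists_cone_takeW_subset {U : Set (Cantor n)} (hU : IsOpen U) {χ : Cantor n}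
    (hχ : χ ∈ U) : ∃ k, cone (takeW χ k) ⊆ U := by
  obtain ⟨_, ⟨ψ, k, rfl⟩, hmem, hsub⟩ :=
    (PiNat.isTopologicalBasis_cylinders _).exists_subset_of_mem_open hχ hU
  refine ⟨k, ?_⟩
  rw [cone_takeW, PiNat.mem_cylinder_iff_eq.1 hmem]
  exact hsub

theorem eq_of_common_prefixes {χ ψ : Cantor n}
    (h : ∀ m : ℕ, ∃ u : List (Fin n), m ≤ u.length ∧ PrefixOf u χ ∧ PrefixOf u ψ) : χ = ψ := by
  funext i
  obtain ⟨u, hm, h₁, h₂⟩ := h (i + 1)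
  exact (h₁ i hm).symm.trans (h₂ i hm)

theorem prefix_of_cone_subset (hn : 2 ≤ n) {u v : List (Fin n)} (h : cone v ⊆ cone u) :
    u <+: v := by
  have h₀ : PrefixOf u (appendInf v fun _ => ⟨0, by omega⟩) := h (prefixOf_appendInf v _)
  have h₁ : PrefixOf u (appendInf v fun _ => ⟨1, by omega⟩) := h (prefixOf_appendInf v _)
  refine h₀.prefix_of_length_le (prefixOf_appendInf v _) (not_lt.1 fun hlt => ?_)
  have := (h₀ _ hlt).symm.trans (h₁ _ hlt)
  simp [appendInf] at this

theorem nontrivial_cone (hn : 2 ≤ n) (v : List (Fin n)) : (cone v).Nontrivial := by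
  refine ⟨_, prefixOf_appendInf v fun _ => ⟨0, by omega⟩,
    _, prefixOf_appendInf v fun _ => ⟨1, by omega⟩, fun h => ?_⟩
  simpa using congrFun (appendInf_injective v h) 0

theorem exists_isLCP {A : Set (Cantor n)} (hA : A.Nontrivial) : ∃ l, IsLCP A l := by
  obtain ⟨χ, hχ, ψ, hψ, hne⟩ := hA
  obtain ⟨i, hi⟩ := Function.ne_iff.1 hne
  set S : Set ℕ := {m | ∃ l : List (Fin n), (∀ ρ ∈ A, PrefixOf l ρ) ∧ l.length = m}
  have hne : S.Nonempty := ⟨0, [], fun ρ _ => prefixOf_nil ρ, rfl⟩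
  have hbdd : BddAbove S := by
    refine ⟨i, ?_⟩
    rintro _ ⟨l, hl, rfl⟩
    exact not_lt.1 fun hlt => hi ((hl χ hχ i hlt).symm.trans (hl ψ hψ i hlt))
  obtain ⟨l, hl, hlen⟩ := Nat.sSup_mem hne hbdd
  exact ⟨l, hl, fun l' hl' => hlen ▸ le_csSup hbdd ⟨l', hl', rfl⟩⟩

theorem isLCP_image_appendInf_iff {A : Set (Cantor n)} (hA : A.Nonempty) {u l : List (Fin n)} :
    IsLCP (appendInf u '' A) (u ++ l) ↔ IsLCP A l := by
  simp only [IsLCP, Set.forall_mem_image, prefixOf_append_appendInf_iff]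
  refine and_congr_right fun hl => ⟨fun h l' hl' => ?_, fun h l' hl' => ?_⟩
  · simpa using h (u ++ l') fun ρ hρ => prefixOf_append_appendInf_iff.2 (hl' ρ hρ)
  · obtain ⟨ρ₀, hρ₀⟩ := hA
    rcases le_total l'.length u.length with hle | hle
    · simp only [List.length_append]
      omega
    · obtain ⟨t, rfl⟩ := (prefixOf_appendInf u ρ₀).prefix_of_length_le (hl' hρ₀) hle
      simpa using h t fun ρ hρ => prefixOf_append_appendInf_iff.1 (hl' hρ)

/-- A finite uniform depth suffices to refine an open cover of Cantor space by sets `A i`,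
with a lower bound `d i` on the depths at which `A i` may be used. -/
theorem exists_uniform_depth {ι : Type*} (A : ι → Set (Cantor n)) (d : ι → ℕ)
    (hA : ∀ i, IsOpen (A i)) (hcover : ⋃ i, A i = Set.univ) :
    ∃ K : ℕ, ∀ χ : Cantor n, ∃ i, d i ≤ K ∧ cone (takeW χ K) ⊆ A i := by
  let U : ℕ → Set (Cantor n) := fun k => {χ | ∃ i, d i ≤ k ∧ cone (takeW χ k) ⊆ A i}
  have hmono : Monotone U := fun k l hkl χ ⟨i, hi, hsub⟩ =>
    ⟨i, hi.trans hkl, (cone_takeW_anti χ hkl).trans hsub⟩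
  have hopen : ∀ k, IsOpen (U k) := by
    intro k
    rw [isOpen_iff_mem_nhds]
    rintro χ ⟨i, hi, hsub⟩
    refine Filter.mem_of_superset
      ((isOpen_cone (takeW χ k)).mem_nhds (prefixOf_takeW χ k)) fun ψ hψ => ⟨i, hi, ?_⟩
    rw [cone_takeW, PiNat.mem_cylinder_iff_eq.1 (by rwa [← cone_takeW] : ψ ∈ PiNat.cylinder χ k),
      ← cone_takeW]
    exact hsub
  have hU : (Set.univ : Set (Cantor n)) ⊆ ⋃ k, U k := by
    intro χ _
    obtain ⟨i, hi⟩ := Set.mem_iUnion.1 (hcover.symm ▸ Set.mem_univ χ : χ ∈ ⋃ i, A i)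
    obtain ⟨k, hk⟩ := exists_cone_takeW_subset (hA i) hi
    exact Set.mem_iUnion.2 ⟨max (d i) k, i, le_max_left _ _,
      (cone_takeW_anti χ (le_max_right _ _)).trans hk⟩
  obtain ⟨K, hK⟩ := isCompact_univ.elim_directed_cover U hopen hU hmono.directed_le
  exact ⟨K, fun χ => hK (Set.mem_univ χ)⟩

/-- The enumeration of all words of length `K`. -/
def wordEnum (n K : ℕ) (j : Fin (n ^ K)) : List (Fin n) :=
  List.ofFn (finFunctionFinEquiv.symm j)

theorem length_wordEnum (K : ℕ) (j : Fin (n ^ K)) : (wordEnum n K j).length = K := by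
  simp [wordEnum]

theorem antichainFam_wordEnum (n K : ℕ) : AntichainFam (wordEnum n K) := by
  intro χ
  refine ⟨finFunctionFinEquiv fun i : Fin K => χ i, ?_, fun j hj => ?_⟩
  · simp [wordEnum, prefixOf_iff_getElem]
  · rw [← Equiv.symm_apply_eq]
    funext i
    simpa [wordEnum] using hj i (by simp [wordEnum])

theorem pow_mod_pred (hn : 2 ≤ n) (K : ℕ) : n ^ K % (n - 1) = 1 % (n - 1) := by
  obtain ⟨m, rfl⟩ : ∃ m, n = m + 1 := ⟨n - 1, by omega⟩
  have : m + 1 ≡ 1 [MOD m] := by simp [Nat.ModEq]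
  simpa [Nat.ModEq] using this.pow K

end CantorWords

namespace Transducer

variable {n : ℕ} {T : Transducer n}

theorem outStar_append (u v : List (Fin n)) (q : T.Q) :
    T.outStar (u ++ v) q = T.outStar u q ++ T.outStar v (T.transStar u q) := by
  induction u generalizing q with
  | nil => rfl
  | cons x u ih => simp [outStar, transStar, ih]

theorem outStar_mono {u v : List (Fin n)} (h : u <+: v) (q : T.Q) :
    T.outStar u q <+: T.outStar v q := by
  obtain ⟨t, rfl⟩ := h
  rw [outStar_append]
  exact List.prefix_append _ _

theorem Induces.prefixOf {q : T.Q} {f : Cantor n → Cantor n} (hf : T.Induces q f)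
    {u : List (Fin n)} {χ : Cantor n} (hu : PrefixOf u χ) : PrefixOf (T.outStar u q) (f χ) := by
  obtain ⟨k, hlen, hk⟩ := hf χ (T.outStar u q).length
  rcases le_total u.length (takeW χ k).length with hle | hle
  · exact hk.mono (outStar_mono (hu.prefix_of_length_le (prefixOf_takeW χ k) hle) q)
  · have hpre := outStar_mono ((prefixOf_takeW χ k).prefix_of_length_le hu hle) q
    rwa [← hpre.eq_of_length_le hlen]

theorem Induces.unique {q : T.Q} {f g : Cantor n → Cantor n} (hf : T.Induces q f)
    (hg : T.Induces q g) : f = g := by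
  funext χ
  refine eq_of_common_prefixes fun m => ?_
  obtain ⟨k, hlen, hk⟩ := hf χ m
  exact ⟨_, hlen, hk, hg.prefixOf (prefixOf_takeW χ k)⟩

theorem Induces.appendInf {q : T.Q} {f g : Cantor n → Cantor n} {u : List (Fin n)}
    (hf : T.Induces q f) (hg : T.Induces (T.transStar u q) g) (χ : Cantor n) :
    f (appendInf u χ) = _root_.appendInf (T.outStar u q) (g χ) := by
  refine eq_of_common_prefixes fun m => ?_
  obtain ⟨k, hlen, hk⟩ := hg χ m
  refine ⟨T.outStar (u ++ takeW χ k) q, ?_,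
    hf.prefixOf (prefixOf_append_appendInf_iff.2 (prefixOf_takeW χ k)), ?_⟩
  · rw [outStar_append, List.length_append]
    omega
  · rw [outStar_append]
    exact prefixOf_append_appendInf_iff.2 hk

theorem Induces.continuous {q : T.Q} {f : Cantor n → Cantor n} (hf : T.Induces q f) :
    Continuous f := by
  rw [continuous_pi_iff]
  intro i
  rw [continuous_iff_continuousAt]
  intro χ
  obtain ⟨k, hlen, hk⟩ := hf χ (i + 1)
  refine (continuousAt_const (y := f χ i)).congr (Filter.mem_of_superset
    ((isOpen_cone (takeW χ k)).mem_nhds (prefixOf_takeW χ k)) fun ψ hψ => ?_)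
  exact (hk i hlen).symm.trans (hf.prefixOf hψ i hlen)

theorem Induces.inducedMap_eq {q : T.Q} {f : Cantor n → Cantor n} (hf : T.Induces q f) :
    T.inducedMap q = f := by
  have h : ∃ f, T.Induces q f := ⟨f, hf⟩
  rw [inducedMap, dif_pos h]
  exact h.choose_spec.unique hf

theorem PartiallyInvertible.induces (hT : T.PartiallyInvertible) (q : T.Q) :
    T.Induces q (T.inducedMap q) := by
  obtain ⟨f, hf, -⟩ := hT q
  rwa [hf.inducedMap_eq]

theorem PartiallyInvertible.injective (hT : T.PartiallyInvertible) (q : T.Q) :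
    Function.Injective (T.inducedMap q) := by
  obtain ⟨f, hf, hinj, -⟩ := hT q
  rwa [hf.inducedMap_eq]

theorem PartiallyInvertible.stateImage_eq (hT : T.PartiallyInvertible) (q : T.Q) :
    T.stateImage q = Set.range (T.inducedMap q) := by
  ext y
  constructor
  · rintro ⟨f, χ, hf, rfl⟩
    exact ⟨χ, by rw [hf.inducedMap_eq]⟩
  · rintro ⟨χ, rfl⟩
    exact ⟨_, χ, hT.induces q, rfl⟩

theorem lcp_spec {q : T.Q} {v : List (Fin n)} (h : (T.inducedMap q ⁻¹' cone v).Nontrivial) :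
    IsLCP (T.inducedMap q ⁻¹' cone v) (T.lcp q v) := by
  have h' : ∃ l, IsLCP {ρ : Cantor n | T.inducedMap q ρ ∈ cone v} l := exists_isLCP h
  rw [lcp, dif_pos h']
  exact h'.choose_spec

theorem nontrivial_preimage_cone (hn : 2 ≤ n) {q : T.Q} {v : List (Fin n)}
    (hv : cone v ⊆ Set.range (T.inducedMap q)) : (T.inducedMap q ⁻¹' cone v).Nontrivial :=
  Set.nontrivial_of_image _ _ ((Set.image_preimage_eq_of_subset hv).symm ▸ nontrivial_cone hn v)

theorem outStar_lcp_prefix_of_cone_subset (hn : 2 ≤ n) (hT : T.PartiallyInvertible) {q : T.Q}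
    {v : List (Fin n)} (hv : cone v ⊆ Set.range (T.inducedMap q)) :
    T.outStar (T.lcp q v) q <+: v := by
  refine prefix_of_cone_subset hn fun y hy => ?_
  obtain ⟨χ, rfl⟩ := hv hy
  exact (hT.induces q).prefixOf ((lcp_spec (nontrivial_preimage_cone hn hv)).1 χ hy)

/-- The pair `(v - λ(𝓛_q(v), q), π(𝓛_q(v), q))` reached by the inversion algorithm. -/
def residual (T : Transducer n) (q : T.Q) (v : List (Fin n)) : List (Fin n) × T.Q :=
  (v.drop (T.outStar (T.lcp q v) q).length, T.transStar (T.lcp q v) q)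

theorem outStar_lcp_append_residual (hn : 2 ≤ n) (hT : T.PartiallyInvertible) {q : T.Q}
    {v : List (Fin n)} (hv : cone v ⊆ Set.range (T.inducedMap q)) :
    T.outStar (T.lcp q v) q ++ (T.residual q v).1 = v :=
  List.prefix_append_drop (outStar_lcp_prefix_of_cone_subset hn hT hv) |>.symm

theorem inducedMap_appendInf (hT : T.PartiallyInvertible) (q : T.Q) (u : List (Fin n))
    (χ : Cantor n) : T.inducedMap q (appendInf u χ) =
      appendInf (T.outStar u q) (T.inducedMap (T.transStar u q) χ) :=
  (hT.induces q).appendInf (hT.induces _) χ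

theorem preimage_cone_append (hn : 2 ≤ n) (hT : T.PartiallyInvertible) {q : T.Q}
    {v : List (Fin n)} (hv : cone v ⊆ Set.range (T.inducedMap q)) (u : List (Fin n)) :
    T.inducedMap q ⁻¹' cone (v ++ u) = appendInf (T.lcp q v) ''
      (T.inducedMap (T.residual q v).2 ⁻¹' cone ((T.residual q v).1 ++ u)) := by
  have key : ∀ δ, T.inducedMap q (appendInf (T.lcp q v) δ) ∈ cone (v ++ u) ↔
      T.inducedMap (T.residual q v).2 δ ∈ cone ((T.residual q v).1 ++ u) := by
    intro δ
    have hvu : v ++ u = T.outStar (T.lcp q v) q ++ ((T.residual q v).1 ++ u) := by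
      rw [← List.append_assoc, outStar_lcp_append_residual hn hT hv]
    rw [inducedMap_appendInf hT, hvu]
    exact prefixOf_append_appendInf_iff
  ext χ
  constructor
  · intro hχ
    obtain ⟨δ, rfl⟩ := ((lcp_spec (nontrivial_preimage_cone hn hv)).1 χ
      (cone_anti (List.prefix_append v u) hχ)).exists_appendInf
    exact ⟨δ, (key δ).1 hχ, rfl⟩
  · rintro ⟨δ, hδ, rfl⟩
    exact (key δ).2 hδ

theorem goodPair_residual (hn : 2 ≤ n) (hT : T.PartiallyInvertible) {q : T.Q}
    {v : List (Fin n)} (hv : cone v ⊆ Set.range (T.inducedMap q)) :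
    T.GoodPair (T.residual q v) := by
  have himage := preimage_cone_append hn hT hv []
  simp only [List.append_nil] at himage
  have hne := nontrivial_preimage_cone hn hv
  constructor
  · rw [hT.stateImage_eq]
    intro y hy
    have hmem : appendInf (T.outStar (T.lcp q v) q) y ∈ cone v := by
      have hmem' := prefixOf_append_appendInf_iff (u := T.outStar (T.lcp q v) q).2 hy
      rwa [outStar_lcp_append_residual hn hT hv] at hmem'
    obtain ⟨χ, hχ⟩ := hv hmem
    obtain ⟨δ, rfl⟩ := ((lcp_spec hne).1 χ (by rwa [Set.mem_preimage, hχ])).exists_appendInf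
    rw [inducedMap_appendInf hT] at hχ
    exact ⟨δ, appendInf_injective _ hχ⟩
  · have hlcp := lcp_spec hne
    rw [himage] at hlcp
    refine (isLCP_image_appendInf_iff (u := T.lcp q v) ?_).1 (by rwa [List.append_nil])
    exact Set.Nonempty.of_image (himage ▸ hne.nonempty)

theorem cone_subset_range (hT : T.PartiallyInvertible) (s : T.partialInv.Q) :
    cone s.1.1 ⊆ Set.range (T.inducedMap s.1.2) :=
  hT.stateImage_eq s.1.2 ▸ s.2.1

theorem isLCP_outStar_partialInv (hn : 2 ≤ n) (hT : T.PartiallyInvertible) (u : List (Fin n))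
    (s : T.partialInv.Q) :
    IsLCP (T.inducedMap s.1.2 ⁻¹' cone (s.1.1 ++ u)) (T.partialInv.outStar u s) := by
  induction u generalizing s with
  | nil => exact (List.append_nil s.1.1).symm ▸ s.2.2
  | cons x u ih =>
    have hv : cone (s.1.1 ++ [x]) ⊆ Set.range (T.inducedMap s.1.2) :=
      (cone_anti (List.prefix_append _ _)).trans (cone_subset_range hT s)
    have htr : T.partialInv.tr x s = ⟨T.residual s.1.2 (s.1.1 ++ [x]),
        goodPair_residual hn hT hv⟩ := dif_pos (goodPair_residual hn hT hv)
    have himage := preimage_cone_append hn hT hv u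
    have hne : (T.inducedMap s.1.2 ⁻¹' cone (s.1.1 ++ [x] ++ u)).Nonempty :=
      (nontrivial_preimage_cone hn
        ((cone_anti (List.prefix_append _ _)).trans hv)).nonempty
    have hstep := ih ⟨T.residual s.1.2 (s.1.1 ++ [x]), goodPair_residual hn hT hv⟩
    rw [himage] at hne
    rw [List.append_cons, himage]
    change IsLCP _ (T.lcp s.1.2 (s.1.1 ++ [x]) ++ T.partialInv.outStar u (T.partialInv.tr x s))
    rw [htr]
    exact (isLCP_image_appendInf_iff hne.of_image).2 hstep

/-- The state `(w, q)` of the partial inverse induces `δ ↦ (wδ)T_q⁻¹`. -/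
theorem partialInv_induces (hn : 2 ≤ n) (hT : T.PartiallyInvertible) (s : T.partialInv.Q)
    {g : Cantor n → Cantor n} (hg : ∀ δ, T.inducedMap s.1.2 (g δ) = appendInf s.1.1 δ) :
    T.partialInv.Induces s g := by
  intro χ m
  set C : Set (Cantor n) := T.inducedMap s.1.2 '' (cone (takeW (g χ) m))ᶜ
  have hclosed : IsClosed C :=
    ((isOpen_cone _).isClosed_compl.isCompact.image (hT.induces _).continuous).isClosed
  have hmem : appendInf s.1.1 χ ∈ Cᶜ := by
    rintro ⟨ψ, hψ, heq⟩
    rw [hT.injective _ (heq.trans (hg χ).symm)] at hψ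
    exact hψ (prefixOf_takeW _ _)
  obtain ⟨k, hk⟩ := exists_cone_takeW_subset hclosed.isOpen_compl hmem
  have hlcp := isLCP_outStar_partialInv hn hT (takeW χ k) s
  have hpre : PrefixOf (s.1.1 ++ takeW χ k) (appendInf s.1.1 χ) :=
    prefixOf_append_appendInf_iff.2 (prefixOf_takeW χ k)
  refine ⟨k, ?_, hlcp.1 _ ?_⟩
  · rw [← length_takeW (g χ) m]
    refine hlcp.2 _ fun ρ hρ => ?_
    by_contra hnot
    refine hk (cone_anti ?_ hρ) ⟨ρ, hnot, rfl⟩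
    exact (prefixOf_takeW _ _).prefix_of_length_le hpre (by simp [length_takeW])
  · rw [Set.mem_preimage, hg]
    exact hpre

/-- On a cone inside the image of `T_q`, the inverse of `T_q` is given by a state of the
partial inverse. -/
theorem exists_partialInv_state (hn : 2 ≤ n) (hT : T.PartiallyInvertible) {q : T.Q}
    {v : List (Fin n)} (hv : cone v ⊆ Set.range (T.inducedMap q)) :
    ∃ (s : T.partialInv.Q) (g : Cantor n → Cantor n) (u : List (Fin n)),
      T.partialInv.Induces s g ∧
        ∀ χ, T.inducedMap q (appendInf u (g χ)) = appendInf v χ := by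
  let s : T.partialInv.Q := ⟨T.residual q v, goodPair_residual hn hT hv⟩
  choose g hg using fun δ => cone_subset_range hT s (prefixOf_appendInf s.1.1 δ)
  refine ⟨s, g, T.lcp q v, partialInv_induces hn hT s hg, fun χ => ?_⟩
  rw [inducedMap_appendInf hT]
  refine (congrArg _ (hg χ)).trans ?_
  rw [← appendInf_append, outStar_lcp_append_residual hn hT hv]

/-- A homeomorphism acting on every cone of some fixed depth as a state, up to prefixes,
is a completion. -/
theorem isCompletion_of_uniform_depth (hn : 2 ≤ n) (U : Transducer n)
    (h : Cantor n ≃ₜ Cantor n) (K : ℕ)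
    (hK : ∀ v : List (Fin n), v.length = K → ∃ (ρ : List (Fin n)) (s : U.Q)
      (g : Cantor n → Cantor n), U.Induces s g ∧
        ∀ χ, h (appendInf v χ) = appendInf ρ (g χ)) : U.IsCompletion h := by
  choose ρ s g hg hh using fun j : Fin (n ^ K) => hK (wordEnum n K j) (length_wordEnum K j)
  have hanti := antichainFam_wordEnum n K
  have himage : ∀ j, appendInf (ρ j) '' Set.range (g j) = h '' cone (wordEnum n K j) := by
    intro j
    rw [← range_appendInf, ← Set.range_comp, ← Set.range_comp]
    exact congrArg Set.range (funext fun χ => (hh j χ).symm)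
  refine ⟨n ^ K, wordEnum n K, ρ, s, g, pow_mod_pred hn K, hanti, hg, ?_, fun i j hij => ?_, hh⟩
  · simp only [himage, ← Set.image_iUnion]
    have hcover : ⋃ j, cone (wordEnum n K j) = Set.univ :=
      Set.iUnion_eq_univ_iff.2 fun χ => (hanti χ).exists
    rw [hcover, Set.image_univ, h.range_coe]
  · rw [himage, himage]
    refine Set.disjoint_image_of_injective h.injective (Set.disjoint_left.2 fun χ hi hj => ?_)
    exact hij ((hanti χ).unique hi hj)

end Transducer

/-- Lemma 6.10. Let `T ∈ 𝔓ₙ` with partial inverse `T'`.  If `h` is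
any completion of `T` in the homeomorphism group of Cantor space, then `h⁻¹` is a
completion of `T'`. -/
theorem inverse_of_completion_is_completion_of_partial_inverse
    {n : ℕ} (hn : 2 ≤ n) (T : Transducer n) [Finite T.Q]
    (hPI : T.PartiallyInvertible)
    (h : Cantor n ≃ₜ Cantor n) (hc : T.IsCompletion h) :
    (T.partialInv).IsCompletion h.symm := by
  obtain ⟨l, η, ρ, p, f, -, hη, hf, hunion, -, hh⟩ := hc
  have himage : ∀ i, appendInf (ρ i) '' Set.range (f i) = h '' cone (η i) := by
    intro i
    rw [← range_appendInf, ← Set.range_comp, ← Set.range_comp]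
    exact congrArg Set.range (funext fun χ => (hh i χ).symm)
  obtain ⟨K, hK⟩ := exists_uniform_depth (fun i => appendInf (ρ i) '' Set.range (f i))
    (fun i => (ρ i).length) (fun i => himage i ▸ h.isOpenMap _ (isOpen_cone _)) hunion
  refine Transducer.isCompletion_of_uniform_depth hn _ _ K fun v hv => ?_
  obtain ⟨ψ, hψ⟩ := (nontrivial_cone hn v).nonempty
  obtain ⟨i, hi, hsub⟩ := hK ψ
  rw [← hv, ← PrefixOf.eq_takeW hψ] at hsub
  have hρv : cone v ⊆ cone (ρ i) := by
    rw [← range_appendInf (ρ i)]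
    exact hsub.trans (Set.image_subset_range _ _)
  obtain ⟨v', rfl⟩ := prefix_of_cone_subset hn hρv
  have hv' : cone v' ⊆ Set.range (T.inducedMap (p i)) := by
    intro χ hχ
    obtain ⟨y, hy, heq⟩ := hsub (prefixOf_append_appendInf_iff.2 hχ)
    rw [(hf i).inducedMap_eq, ← appendInf_injective _ heq]
    exact hy
  obtain ⟨s, g, u, hg, hgu⟩ := Transducer.exists_partialInv_state hn hPI hv'
  refine ⟨η i ++ u, s, g, hg, fun χ => ?_⟩
  rw [Homeomorph.symm_apply_eq, appendInf_append, appendInf_append, hh, ← (hf i).inducedMap_eq, hgu]
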